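/- arXiv:0807.0921 — 7 statements merged into one kernel-verified Lean document; each statement's English description precedes it below -/
import Mathlib

section
/- Let S ⊆ ℝ₊ⁿ, let V = span(S), and let y ∈ ℝ₊ⁿ. Then y ∈ V if and only if for every index j ∈ supp(y) there exists v ∈ S with v ≤_j y. -/
open scoped NNReal Classical

namespace MaxAlg

noncomputable section

variable {n m k N : ℕ}

/-- Support of a vector in `ℝ₊ⁿ`. -/
def supp (y : Fin n → ℝ≥0) : Set (Fin n) := { i | y i ≠ 0 }

/-- The multiorder relation `u ≤_j v`. -/
def leOrd (j : Fin n) (u v : Fin n → ℝ≥0) : Prop :=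
  u j ≠ 0 ∧ v j ≠ 0 ∧ ∀ i, u i / u j ≤ v i / v j

/-- Max span of a set of vectors: all finite max combinations. -/
def maxSpan (S : Set (Fin n → ℝ≥0)) : Set (Fin n → ℝ≥0) :=
  { y | ∃ (F : Finset (Fin n → ℝ≥0)) (lam : (Fin n → ℝ≥0) → ℝ≥0),
      ↑F ⊆ S ∧ y = F.sup fun v => lam v • v }

/-- A max cone: closed under componentwise max and nonnegative scaling. -/
def IsMaxCone (V : Set (Fin n → ℝ≥0)) : Prop :=
  (∀ u ∈ V, ∀ w ∈ V, u ⊔ w ∈ V) ∧ ∀ (c : ℝ≥0), ∀ u ∈ V, c • u ∈ V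

/-- Extremal vector of a max cone. -/
def IsExtremal (V : Set (Fin n → ℝ≥0)) (v : Fin n → ℝ≥0) : Prop :=
  v ∈ V ∧ v ≠ 0 ∧ ∀ u ∈ V, ∀ w ∈ V, v = u ⊔ w → v = u ∨ v = w

/-- Minimality w.r.t. `≤_j` in a set `W`. -/
def MinimalOrd (j : Fin n) (W : Set (Fin n → ℝ≥0)) (v : Fin n → ℝ≥0) : Prop :=
  v ∈ W ∧ v j ≠ 0 ∧ ∀ u ∈ W, leOrd j u v → leOrd j v u

/-- Max-algebraic matrix-vector product. -/
def mulVec (A : Matrix (Fin n) (Fin m) ℝ≥0) (x : Fin m → ℝ≥0) : Fin n → ℝ≥0 :=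
  fun i => Finset.univ.sup fun j => A i j * x j

/-- Max-algebraic column span of a matrix. -/
def matSpan (A : Matrix (Fin n) (Fin m) ℝ≥0) : Set (Fin n → ℝ≥0) :=
  { y | ∃ x : Fin m → ℝ≥0, y = mulVec A x }

/-- Max-algebraic matrix product. -/
def mProd (A B : Matrix (Fin n) (Fin n) ℝ≥0) : Matrix (Fin n) (Fin n) ℝ≥0 :=
  fun i j => Finset.univ.sup fun t => A i t * B t j

/-- Max-algebraic identity matrix. -/
def mId (n : ℕ) : Matrix (Fin n) (Fin n) ℝ≥0 :=
  fun i j => if i = j then 1 else 0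

/-- Max-algebraic matrix power. -/
def mPow (A : Matrix (Fin n) (Fin n) ℝ≥0) : ℕ → Matrix (Fin n) (Fin n) ℝ≥0
  | 0 => mId n
  | t + 1 => mProd (mPow A t) A

/-- Maximum cycle geometric mean `λ(A)`. -/
def maxCycleMean (A : Matrix (Fin n) (Fin n) ℝ≥0) : ℝ≥0 :=
  sSup { w | ∃ (p : ℕ) (hp : 0 < p) (c : Fin p → Fin n),
    w = (∏ t : Fin p, A (c t) (c ⟨((t : ℕ) + 1) % p, Nat.mod_lt _ hp⟩)) ^ ((1 : ℝ) / (p : ℝ)) }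

/-- Kleene star `A* = I ⊕ A ⊕ ⋯ ⊕ A^{n-1}`. -/
def kleene (A : Matrix (Fin n) (Fin n) ℝ≥0) : Matrix (Fin n) (Fin n) ℝ≥0 :=
  fun i j => (Finset.range n).sup fun t => mPow A t i j

/-- Eigencone `V(A)`. -/
def eigCone (A : Matrix (Fin n) (Fin n) ℝ≥0) : Set (Fin n → ℝ≥0) :=
  { x | mulVec A x = x }

/-- Subeigencone `V*(A)`. -/
def subEigCone (A : Matrix (Fin n) (Fin n) ℝ≥0) : Set (Fin n → ℝ≥0) :=
  { x | mulVec A x ≤ x }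

/-- Kleene star predicate: multiplicatively idempotent with unit diagonal. -/
def IsKleeneStar (Q : Matrix (Fin n) (Fin n) ℝ≥0) : Prop :=
  mProd Q Q = Q ∧ ∀ i, Q i i = 1

/-- Projector onto a (closed) max cone: `P_V(y) = max{v ∈ V ∣ v ≤ y}`. -/
def proj (V : Set (Fin n → ℝ≥0)) (y : Fin n → ℝ≥0) : Fin n → ℝ≥0 :=
  fun i => sSup ((fun v => v i) '' { v ∈ V | v ≤ y })

/-- Residuation `y / v = min_{i ∈ supp v} yᵢ/vᵢ`. -/
def resid (y v : Fin n → ℝ≥0) : ℝ≥0 :=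
  sInf ((fun i => y i / v i) '' supp v)

/-- `(i,j)` is a critical edge: it lies on a cycle of geometric-mean weight 1. -/
def IsCriticalEdge (B : Matrix (Fin n) (Fin n) ℝ≥0) (i j : Fin n) : Prop :=
  ∃ (p : ℕ) (hp : 0 < p) (c : Fin p → Fin n) (t : Fin p),
    c t = i ∧ c ⟨((t : ℕ) + 1) % p, Nat.mod_lt _ hp⟩ = j ∧
    (∏ s : Fin p, B (c s) (c ⟨((s : ℕ) + 1) % p, Nat.mod_lt _ hp⟩)) ^ ((1 : ℝ) / (p : ℝ)) = 1

/-- The matrix `A^S` associated with an `n`-tuple `S` of subsets of `[m]`. -/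
def typeMat (A : Matrix (Fin n) (Fin m) ℝ≥0) (S : Fin n → Set (Fin m)) :
    Matrix (Fin n) (Fin n) ℝ≥0 :=
  fun i j =>
    if S j = ∅ then (if i = j then 1 else 0)
    else sSup ((fun t => A i t / A j t) '' S j)

/-- The closed region `cl(X_S)`. -/
def clRegion (A : Matrix (Fin n) (Fin m) ℝ≥0) (S : Fin n → Set (Fin m)) :
    Set (Fin n → ℝ≥0) :=
  { y | ∀ t i : Fin n, ∀ j ∈ S i, A t j / A i j * y i ≤ y t }

/-- Row type of a positive vector w.r.t. a matrix. -/
def rowType (A : Matrix (Fin n) (Fin m) ℝ≥0) (y : Fin n → ℝ≥0) : Fin n → Set (Fin m) :=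
  fun i => { j | ∀ t, A t j / y t ≤ A i j / y i }

/-- Max-algebraic permanent. -/
def maxPer (A : Matrix (Fin n) (Fin n) ℝ≥0) : ℝ≥0 :=
  Finset.univ.sup fun σ : Equiv.Perm (Fin n) => ∏ i, A i (σ i)

/-- Max-algebraic pseudoinverse `A^∇ = per(A)⁻¹ ⋅ A^adj`, where
`(A^adj)_{ij} = per(A_{ji})`. -/
def pinv (A : Matrix (Fin (N + 1)) (Fin (N + 1)) ℝ≥0) :
    Matrix (Fin (N + 1)) (Fin (N + 1)) ℝ≥0 :=
  fun i j => (maxPer A)⁻¹ * maxPer (A.submatrix j.succAbove i.succAbove)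

/-- Column normalization `A^{cσ}`. -/
def colNorm (A : Matrix (Fin n) (Fin n) ℝ≥0) (σ : Equiv.Perm (Fin n)) :
    Matrix (Fin n) (Fin n) ℝ≥0 :=
  fun i j => A i (σ j) / A j (σ j)

/-- Row normalization `A^{rσ}`. -/
def rowNorm (A : Matrix (Fin n) (Fin n) ℝ≥0) (σ : Equiv.Perm (Fin n)) :
    Matrix (Fin n) (Fin n) ℝ≥0 :=
  fun i j => A (σ.symm i) j / A (σ.symm i) i

/-- The diagonal matrix `D^σ`. -/
def permDiag (A : Matrix (Fin n) (Fin n) ℝ≥0) (σ : Equiv.Perm (Fin n)) :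
    Matrix (Fin n) (Fin n) ℝ≥0 :=
  fun i j => if j = σ i then A i j else 0

/-- The cyclic projector `P_k ∘ ⋯ ∘ P_1` onto the column spans of a family of matrices. -/
def cycProj {mdim : Fin k → ℕ} (A : (s : Fin k) → Matrix (Fin n) (Fin (mdim s)) ℝ≥0) :
    (Fin n → ℝ≥0) → Fin n → ℝ≥0 :=
  fun y => (List.ofFn fun s => proj (matSpan (A s))).foldl (fun z f => f z) y

/-- The max-algebraic product `A^(1) ⊗ ⋯ ⊗ A^(k)` of a family of matrices. -/
def prodAll (A : Fin k → Matrix (Fin n) (Fin n) ℝ≥0) : Matrix (Fin n) (Fin n) ℝ≥0 :=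
  (List.ofFn A).foldr mProd (mId n)

/-- The sequence of products `C^(m) = A^{(j(m))} ⊗ ⋯ ⊗ A^{(j(1))}`. -/
def prodSeq (A : Fin k → Matrix (Fin n) (Fin n) ℝ≥0) (j : ℕ → Fin k) :
    ℕ → Matrix (Fin n) (Fin n) ℝ≥0
  | 0 => mId n
  | t + 1 => mProd (A (j (t + 1))) (prodSeq A j t)

/-- Hilbert projective distance, valued in the extended reals. -/
def rhoH (y1 y2 : Fin n → ℝ≥0) : EReal :=
  if supp y1 = supp y2 then
    ((Real.log ((sSup { t : ℝ≥0 | ∃ i ∈ supp y1, ∃ j ∈ supp y1,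
        t = y1 i / y2 i * (y2 j / y1 j) } : ℝ≥0) : ℝ)) : EReal)
  else ⊤

/-- Max-plus (additive) matrix-vector product over `ℝ`. -/
def mpMulVec (A : Matrix (Fin n) (Fin m) ℝ) (x : Fin m → ℝ) : Fin n → ℝ :=
  fun i => ⨆ j, (A i j + x j)

/-- Min-plus residuated product `Ā ⊗' y` over `ℝ`. -/
def mpDual (A : Matrix (Fin n) (Fin m) ℝ) (y : Fin n → ℝ) : Fin m → ℝ :=
  fun j => ⨅ i, (y i - A i j)

/-- Max-plus projector onto the column span of `A`: `P_A(y) = A ⊗ (Ā ⊗' y)`. -/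
def mpProj (A : Matrix (Fin n) (Fin m) ℝ) (y : Fin n → ℝ) : Fin n → ℝ :=
  mpMulVec A (mpDual A y)

/-- Range seminorm `‖A‖ = max_{i,j,l}(a_{il} − a_{jl})`. -/
def mpNorm (A : Matrix (Fin n) (Fin m) ℝ) : ℝ :=
  ⨆ i, ⨆ j, ⨆ l, (A i l - A j l)

/-- One sweep `P_k ∘ ⋯ ∘ P_1` of the max-plus alternating method. -/
def altStep {mdim : Fin k → ℕ} (A : (s : Fin k) → Matrix (Fin n) (Fin (mdim s)) ℝ) :
    (Fin n → ℝ) → Fin n → ℝ :=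
  fun y => (List.ofFn fun s => mpProj (A s)).foldl (fun z f => f z) y

end

/-- If `u ≤_j v`, the multiple of `u` agreeing with `v` at `j` lies below `v`. -/
theorem leOrd.smul_le {n : ℕ} {j : Fin n} {u v : Fin n → ℝ≥0} (h : leOrd j u v) :
    (v j / u j) • u ≤ v := by
  obtain ⟨_, hv, h⟩ := h
  intro i
  calc v j / u j * u i = u i / u j * v j := by ring
    _ ≤ v i / v j * v j := mul_le_mul_left (h i) _
    _ = v i := div_mul_cancel₀ _ hv

/-- A vector with a multiple below `v` that meets `v` at `j ∈ supp v` precedes `v` for `≤_j`. -/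
theorem leOrd_of_smul_le {n : ℕ} {j : Fin n} {u v : Fin n → ℝ≥0} {c : ℝ≥0}
    (hle : c • u ≤ v) (heq : c * u j = v j) (hv : v j ≠ 0) : leOrd j u v := by
  have hc : c ≠ 0 := by rintro rfl; simp at heq; exact hv heq.symm
  have hu : u j ≠ 0 := by intro h; simp [h] at heq; exact hv heq.symm
  refine ⟨hu, hv, fun i => ?_⟩
  rw [← heq, ← mul_div_mul_left (u i) (u j) hc]
  gcongr
  exact hle i

/-- multiorder principle: for `V = span S`, `y ∈ V` iff for every
`j ∈ supp y` there is `v ∈ S` with `v ≤_j y`. -/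
theorem stmt0 {n : ℕ} (S V : Set (Fin n → ℝ≥0)) (hV : V = maxSpan S)
    (y : Fin n → ℝ≥0) :
    y ∈ V ↔ ∀ j ∈ supp y, ∃ v ∈ S, leOrd j v y := by
  subst hV
  constructor
  · rintro ⟨F, lam, hF, rfl⟩ j hj
    have hne : F.Nonempty := by
      rw [Finset.nonempty_iff_ne_empty]
      rintro rfl
      simp [supp] at hj
    obtain ⟨v, hv, hvj⟩ := F.exists_mem_eq_sup hne fun v => lam v * v j
    refine ⟨v, hF hv, leOrd_of_smul_le (c := lam v) ?_ ?_ hj⟩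
    · exact Finset.le_sup (f := fun v => lam v • v) hv
    · rw [Finset.sup_apply]
      exact hvj.symm
  · intro h
    choose! f hfS hf using h
    refine ⟨(Finset.univ.filter (· ∈ supp y)).image f,
      fun v => (Finset.univ.filter fun j => leOrd j v y).sup fun j => y j / v j, ?_, ?_⟩
    · intro v hv
      simp only [Finset.coe_image, Finset.coe_filter, Finset.mem_univ, true_and] at hv
      obtain ⟨j, hj, rfl⟩ := hv
      exact hfS j hj
    · apply le_antisymm
      · intro j
        by_cases hj : y j = 0
        · simp [hj]
        have hlam : y j / f j j ≤
            (Finset.univ.filter fun i => leOrd i (f j) y).sup fun i => y i / f j i :=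
          Finset.le_sup (f := fun i => y i / f j i) (by simpa using hf j hj)
        have hmem : f j ∈ (Finset.univ.filter (· ∈ supp y)).image f :=
          Finset.mem_image_of_mem f (Finset.mem_filter.mpr ⟨Finset.mem_univ j, hj⟩)
        rw [Finset.sup_apply]
        refine le_trans ?_ (Finset.le_sup hmem)
        calc y j = y j / f j j * f j j := (div_mul_cancel₀ _ (hf j hj).1).symm
          _ ≤ _ := mul_le_mul_left hlam _
      · refine Finset.sup_le fun v _ i => ?_
        rw [Pi.smul_apply, smul_eq_mul, NNReal.finset_sup_mul]
        refine Finset.sup_le fun j hj => ?_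
        exact (Finset.mem_filter.mp hj).2.smul_le i

end MaxAlg
end

section
/- Let A ∈ ℝ₊^{n×n} have all diagonal entries equal to 1. Then V*(A) contains a vector all of whose coordinates are positive if and only if A is definite, i.e. λ(A) = 1. -/
open scoped NNReal Classical

namespace MaxAlg

/-- Weight of the walk given by the first `k` steps of `c`. -/
noncomputable def walkWeight {n : ℕ} (A : Matrix (Fin n) (Fin n) ℝ≥0) (c : ℕ → Fin n) (k : ℕ) : ℝ≥0 :=
  ∏ t ∈ Finset.range k, A (c t) (c (t + 1))

theorem mem_subEigCone_iff {n : ℕ} {A : Matrix (Fin n) (Fin n) ℝ≥0} {x : Fin n → ℝ≥0} :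
    x ∈ subEigCone A ↔ ∀ i j, A i j * x j ≤ x i := by
  simp [subEigCone, mulVec, Pi.le_def]

theorem prod_cycle_le_one {n : ℕ} {A : Matrix (Fin n) (Fin n) ℝ≥0} {x : Fin n → ℝ≥0}
    (hx : x ∈ subEigCone A) (hpos : ∀ i, 0 < x i) {p : ℕ} (hp : 0 < p) (c : Fin p → Fin n) :
    ∏ t : Fin p, A (c t) (c ⟨((t : ℕ) + 1) % p, Nat.mod_lt _ hp⟩) ≤ 1 := by
  have : NeZero p := ⟨hp.ne'⟩
  have hshift : ∏ t : Fin p, x (c ⟨((t : ℕ) + 1) % p, Nat.mod_lt _ hp⟩) = ∏ t, x (c t) := by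
    rw [← Equiv.prod_comp (Equiv.addRight (1 : Fin p)) fun t => x (c t)]
    refine Finset.prod_congr rfl fun t _ => ?_
    congr 2
    ext
    simp [Fin.val_add]
  have hP : 0 < ∏ t, x (c t) := Finset.prod_pos fun t _ => hpos _
  refine le_of_mul_le_mul_right ?_ hP
  rw [one_mul]
  nth_rewrite 1 [← hshift]
  rw [← Finset.prod_mul_distrib]
  exact Finset.prod_le_prod' fun t _ => mem_subEigCone_iff.1 hx _ _

theorem prod_cycle_le_of_entry_le {n : ℕ} {A : Matrix (Fin n) (Fin n) ℝ≥0} {M : ℝ≥0}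
    (hM : ∀ i j, A i j ≤ M) {p : ℕ} (hp : 0 < p) (c : Fin p → Fin n) :
    (∏ t : Fin p, A (c t) (c ⟨((t : ℕ) + 1) % p, Nat.mod_lt _ hp⟩)) ^ ((1 : ℝ) / (p : ℝ)) ≤ M := by
  rw [one_div, NNReal.rpow_inv_le_iff (by exact_mod_cast hp), NNReal.rpow_natCast]
  refine (Finset.prod_le_pow_card _ _ M fun t _ => hM _ _).trans ?_
  simp

theorem exists_one_le_entry_le {n : ℕ} (A : Matrix (Fin n) (Fin n) ℝ≥0) :
    ∃ M : ℝ≥0, 1 ≤ M ∧ ∀ i j, A i j ≤ M := by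
  refine ⟨1 ⊔ Finset.univ.sup fun q : Fin n × Fin n => A q.1 q.2, le_sup_left, fun i j => ?_⟩
  exact le_sup_of_le_right
    (Finset.le_sup (f := fun q : Fin n × Fin n => A q.1 q.2) (Finset.mem_univ (i, j)))

theorem walkWeight_le_one_of_closed {n : ℕ} {A : Matrix (Fin n) (Fin n) ℝ≥0}
    (hA : maxCycleMean A = 1) {c : ℕ → Fin n} {p : ℕ} (hc : c p = c 0) :
    walkWeight A c p ≤ 1 := by
  rcases Nat.eq_zero_or_pos p with rfl | hp
  · simp [walkWeight]
  obtain ⟨M, -, hM⟩ := exists_one_le_entry_le A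
  have hle : (∏ t : Fin p, A (c t) (c (((t : ℕ) + 1) % p))) ^ ((1 : ℝ) / (p : ℝ)) ≤ 1 := by
    rw [← hA]
    refine le_csSup ⟨M, ?_⟩ ⟨p, hp, fun t => c t, rfl⟩
    rintro w ⟨q, hq, d, rfl⟩
    exact prod_cycle_le_of_entry_le hM hq d
  rw [one_div, NNReal.rpow_inv_le_iff (by exact_mod_cast hp), NNReal.one_rpow] at hle
  rw [walkWeight, ← Fin.prod_univ_eq_prod_range (fun t => A (c t) (c (t + 1)))]
  refine le_of_eq_of_le (Finset.prod_congr rfl fun t _ => ?_) hle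
  congr 1
  rcases Nat.lt_or_ge (t + 1) p with h | h
  · rw [Nat.mod_eq_of_lt h]
  · have : (t : ℕ) + 1 = p := by omega
    rw [this, Nat.mod_self, hc]

theorem walkWeight_add {n : ℕ} (A : Matrix (Fin n) (Fin n) ℝ≥0) (c : ℕ → Fin n) (a b : ℕ) :
    walkWeight A c (a + b) = walkWeight A c a * walkWeight A (fun t => c (a + t)) b := by
  simp [walkWeight, Finset.prod_range_add, add_assoc]

theorem walkWeight_congr {n : ℕ} (A : Matrix (Fin n) (Fin n) ℝ≥0) {c d : ℕ → Fin n} {k : ℕ}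
    (h : ∀ t ≤ k, c t = d t) : walkWeight A c k = walkWeight A d k := by
  refine Finset.prod_congr rfl fun t ht => ?_
  rw [Finset.mem_range] at ht
  rw [h t (by omega), h (t + 1) (by omega)]

theorem walkWeight_le_pow {n : ℕ} {A : Matrix (Fin n) (Fin n) ℝ≥0}
    (hA : maxCycleMean A = 1) {M : ℝ≥0} (hM1 : 1 ≤ M) (hM : ∀ i j, A i j ≤ M)
    (k : ℕ) (c : ℕ → Fin n) : walkWeight A c k ≤ M ^ n := by
  induction k using Nat.strong_induction_on generalizing c with
  | _ k ih =>
    rcases Nat.lt_or_ge k n with hk | hk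
    · calc walkWeight A c k ≤ M ^ k := by
            simpa [walkWeight] using Finset.prod_le_pow_card (Finset.range k)
              (fun t => A (c t) (c (t + 1))) M fun t _ => hM _ _
        _ ≤ M ^ n := pow_le_pow_right₀ hM1 hk.le
    · obtain ⟨a, b, hab, hbk, hc⟩ : ∃ a b, a < b ∧ b ≤ k ∧ c a = c b := by
        obtain ⟨u, v, huv, h⟩ := Fintype.exists_ne_map_eq_of_card_lt
          (fun t : Fin (k + 1) => c t) (by simpa using Nat.lt_succ_of_le hk)
        rcases lt_or_gt_of_ne huv with h' | h'
        · exact ⟨u, v, h', by omega, h⟩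
        · exact ⟨v, u, h', by omega, h.symm⟩
      obtain ⟨d, rfl⟩ := Nat.exists_eq_add_of_le hab.le
      obtain ⟨e, rfl⟩ := Nat.exists_eq_add_of_le hbk
      let c' : ℕ → Fin n := fun t => if t ≤ a then c t else c (t + d)
      have hhead : walkWeight A c' a = walkWeight A c a :=
        walkWeight_congr A fun t ht => by simp [c', ht]
      have htail : (fun t => c' (a + t)) = fun t => c (a + d + t) := by
        funext t
        rcases Nat.eq_zero_or_pos t with rfl | ht
        · simp [c', hc]
        · simp only [c', if_neg (show ¬ a + t ≤ a by omega)]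
          congr 1
          omega
      have hloop : walkWeight A (fun t => c (a + t)) d ≤ 1 :=
        walkWeight_le_one_of_closed hA (by simpa using hc.symm)
      calc walkWeight A c (a + d + e)
          = walkWeight A c a * walkWeight A (fun t => c (a + t)) d *
              walkWeight A (fun t => c (a + d + t)) e := by
            rw [walkWeight_add, walkWeight_add]
        _ ≤ walkWeight A c a * 1 * walkWeight A (fun t => c (a + d + t)) e := by gcongr
        _ = walkWeight A c' (a + e) := by
            rw [walkWeight_add, hhead, htail, mul_one]
        _ ≤ M ^ n := ih _ (by omega) c'

/-- for `A` with unit diagonal, `V*(A)` contains a positive vector iff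
`A` is definite. -/
theorem stmt5 {n : ℕ} (hn : 0 < n) (A : Matrix (Fin n) (Fin n) ℝ≥0)
    (hdiag : ∀ i, A i i = 1) :
    (∃ x ∈ subEigCone A, ∀ i, 0 < x i) ↔ maxCycleMean A = 1 := by
  constructor
  · rintro ⟨x, hx, hpos⟩
    refine IsGreatest.csSup_eq ⟨⟨1, one_pos, fun _ => ⟨0, hn⟩, by simp [hdiag]⟩, ?_⟩
    rintro w ⟨p, hp, c, rfl⟩
    exact NNReal.rpow_le_one (prod_cycle_le_one hx hpos hp c) (by positivity)
  · intro hA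
    obtain ⟨M, hM1, hM⟩ := exists_one_le_entry_le A
    let W : Fin n → Set ℝ≥0 := fun i => {w | ∃ k c, c 0 = i ∧ w = walkWeight A c k}
    have hbdd : ∀ i, BddAbove (W i) := fun i => ⟨M ^ n, by
      rintro w ⟨k, c, -, rfl⟩
      exact walkWeight_le_pow hA hM1 hM k c⟩
    have hone : ∀ i, 1 ∈ W i := fun i => ⟨0, fun _ => i, rfl, by simp [walkWeight]⟩
    refine ⟨fun i => sSup (W i), mem_subEigCone_iff.2 fun i j => ?_, fun i =>
      one_pos.trans_le (le_csSup (hbdd i) (hone i))⟩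
    rcases eq_or_ne (A i j) 0 with h0 | h0
    · simp [h0]
    rw [← le_div_iff₀' (pos_iff_ne_zero.2 h0)]
    refine csSup_le ⟨1, hone j⟩ ?_
    rintro w ⟨k, c, rfl, rfl⟩
    rw [le_div_iff₀' (pos_iff_ne_zero.2 h0)]
    refine le_csSup (hbdd i) ⟨k + 1, fun t => Nat.casesOn t i c, rfl, ?_⟩
    rw [walkWeight, walkWeight, Finset.prod_range_succ', mul_comm]
    rfl

end MaxAlg
end

section
/- Let K ⊆ ℝ₊ⁿ be a max cone. Then K is a Kleene cone if and only if there exists a matrix B ∈ ℝ₊^{n×n} such that K = {x ∈ ℝ₊ⁿ : b_{ij}·x_j ≤ x_i for all i,j ∈ [n]} and this set contains a vector all of whose coordinates are positive. -/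
open scoped NNReal Classical

namespace MaxAlg

/-- The span of a Kleene star is the solution set of its system of two-variable inequalities. -/
theorem IsKleeneStar.matSpan_eq {n : ℕ} {Q : Matrix (Fin n) (Fin n) ℝ≥0} (hQ : IsKleeneStar Q) :
    matSpan Q = { x : Fin n → ℝ≥0 | ∀ i j, Q i j * x j ≤ x i } := by
  ext x
  constructor
  · rintro ⟨y, rfl⟩ i j
    simp only [mulVec]
    rw [NNReal.mul_finset_sup]
    refine Finset.sup_le fun t _ => ?_
    have h : Q i j * Q j t ≤ Q i t := by
      conv_rhs => rw [← hQ.1]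
      exact Finset.le_sup (f := fun s => Q i s * Q s t) (Finset.mem_univ j)
    rw [← mul_assoc]
    exact (mul_le_mul_left h (y t)).trans
      (Finset.le_sup (f := fun s => Q i s * y s) (Finset.mem_univ t))
  · intro hx
    refine ⟨x, funext fun i => le_antisymm ?_ (Finset.sup_le fun j _ => hx i j)⟩
    have h := Finset.le_sup (f := fun j => Q i j * x j) (Finset.mem_univ i)
    rwa [hQ.2 i, one_mul] at h

/-- The largest coefficients `q i j` for which `q i j * x j ≤ x i` holds on all of `K`. -/
noncomputable def tightCoeff {n : ℕ} (K : Set (Fin n → ℝ≥0)) : Matrix (Fin n) (Fin n) ℝ≥0 :=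
  fun i j => sInf ((fun x => x i / x j) '' { x ∈ K | x j ≠ 0 })

theorem tightCoeff_mul_le {n : ℕ} {K : Set (Fin n → ℝ≥0)} {x : Fin n → ℝ≥0} (hx : x ∈ K)
    (i j : Fin n) : tightCoeff K i j * x j ≤ x i := by
  by_cases h : x j = 0
  · simp [h]
  · exact (le_div_iff₀ (pos_iff_ne_zero.2 h)).1
      (csInf_le (OrderBot.bddBelow _) ⟨x, ⟨hx, h⟩, rfl⟩)

theorem le_tightCoeff {n : ℕ} {K : Set (Fin n → ℝ≥0)} {z : Fin n → ℝ≥0} (hz : z ∈ K)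
    {i j : Fin n} (hzj : z j ≠ 0) {q : ℝ≥0} (h : ∀ x ∈ K, q * x j ≤ x i) :
    q ≤ tightCoeff K i j := by
  refine le_csInf ⟨_, z, ⟨hz, hzj⟩, rfl⟩ ?_
  rintro _ ⟨x, ⟨hx, hxj⟩, rfl⟩
  exact (le_div_iff₀ (pos_iff_ne_zero.2 hxj)).2 (h x hx)

theorem isKleeneStar_tightCoeff {n : ℕ} {K : Set (Fin n → ℝ≥0)} {z : Fin n → ℝ≥0} (hz : z ∈ K)
    (hpos : ∀ i, z i ≠ 0) : IsKleeneStar (tightCoeff K) := by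
  have diag (i : Fin n) : tightCoeff K i i = 1 := by
    refine le_antisymm ?_ (le_tightCoeff hz (hpos i) fun x _ => (one_mul _).le)
    refine le_of_mul_le_mul_right ?_ (pos_iff_ne_zero.2 (hpos i))
    simpa only [one_mul] using tightCoeff_mul_le hz i i
  refine ⟨?_, diag⟩
  ext1 i j
  refine le_antisymm (Finset.sup_le fun t _ => le_tightCoeff hz (hpos j) fun x hx => ?_) ?_
  · rw [mul_assoc]
    exact (mul_le_mul_right (tightCoeff_mul_le hx t j) _).trans (tightCoeff_mul_le hx i t)
  · have h := Finset.le_sup (f := fun t => tightCoeff K i t * tightCoeff K t j)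
      (Finset.mem_univ i)
    rwa [diag i, one_mul] at h

/-- a max cone `K` is a Kleene cone iff it is the solution set of a system
`b_{ij}·x_j ≤ x_i` admitting a positive solution. -/
theorem stmt6 {n : ℕ} (K : Set (Fin n → ℝ≥0)) (hK : IsMaxCone K) :
    (∃ Q : Matrix (Fin n) (Fin n) ℝ≥0, IsKleeneStar Q ∧ K = matSpan Q) ↔
    ∃ B : Matrix (Fin n) (Fin n) ℝ≥0,
      K = { x : Fin n → ℝ≥0 | ∀ i j, B i j * x j ≤ x i } ∧
      ∃ x : Fin n → ℝ≥0, (∀ i j, B i j * x j ≤ x i) ∧ ∀ i, 0 < x i := by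
  constructor
  · rintro ⟨Q, hQ, rfl⟩
    refine ⟨Q, hQ.matSpan_eq, mulVec Q 1, ?_, fun i => ?_⟩
    · have h : mulVec Q 1 ∈ matSpan Q := ⟨1, rfl⟩
      rwa [hQ.matSpan_eq] at h
    · refine zero_lt_one.trans_le ?_
      have h := Finset.le_sup (f := fun j => Q i j * (1 : Fin n → ℝ≥0) j) (Finset.mem_univ i)
      rwa [hQ.2 i, Pi.one_apply, one_mul] at h
  · rintro ⟨B, hKB, z, hz, hpos⟩
    have hzK : z ∈ K := hKB ▸ hz
    have hQ := isKleeneStar_tightCoeff hzK fun i => (hpos i).ne'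
    refine ⟨tightCoeff K, hQ, ?_⟩
    rw [hQ.matSpan_eq]
    refine Set.Subset.antisymm (fun x hx i j => tightCoeff_mul_le hx i j) fun x hx => ?_
    rw [hKB]
    intro i j
    refine (mul_le_mul_left (le_tightCoeff hzK (hpos j).ne' fun y hy => ?_) (x j)).trans (hx i j)
    rw [hKB] at hy
    exact hy i j

end MaxAlg
end

section
/- Let Q, R ∈ ℝ₊^{n×n} be Kleene stars. Then Q = R if and only if span(Q) = span(R). -/
open scoped NNReal Classical

namespace MaxAlg

theorem IsKleeneStar.mul_le_of_mem_matSpan {n : ℕ} {Q : Matrix (Fin n) (Fin n) ℝ≥0}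
    (hQ : IsKleeneStar Q) {y : Fin n → ℝ≥0} (hy : y ∈ matSpan Q) (i j : Fin n) :
    Q i j * y j ≤ y i := by
  obtain ⟨x, rfl⟩ := hy
  simp only [mulVec]
  rw [NNReal.mul_finset_sup]
  refine Finset.sup_le fun t _ => ?_
  have h : Q i j * Q j t ≤ Q i t := by
    conv_rhs => rw [← hQ.1]
    exact Finset.le_sup (f := fun s => Q i s * Q s t) (Finset.mem_univ j)
  calc Q i j * (Q j t * x t) = Q i j * Q j t * x t := (mul_assoc _ _ _).symm
    _ ≤ Q i t * x t := by gcongr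
    _ ≤ _ := Finset.le_sup (f := fun s => Q i s * x s) (Finset.mem_univ t)

theorem col_mem_matSpan {n m : ℕ} (A : Matrix (Fin n) (Fin m) ℝ≥0) (j : Fin m) :
    (fun i => A i j) ∈ matSpan A := by
  refine ⟨Pi.single j 1, funext fun i => le_antisymm ?_ (Finset.sup_le fun t _ => ?_)⟩
  · simpa [mulVec] using Finset.le_sup (f := fun s => A i s * (Pi.single j 1 : Fin m → ℝ≥0) s)
      (Finset.mem_univ j)
  · rcases eq_or_ne t j with rfl | h
    · simp
    · simp [h]

theorem IsKleeneStar.le_of_matSpan_subset {n : ℕ} {Q R : Matrix (Fin n) (Fin n) ℝ≥0}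
    (hQ : IsKleeneStar Q) (hR : IsKleeneStar R) (h : matSpan R ⊆ matSpan Q) (i j : Fin n) :
    Q i j ≤ R i j := by
  simpa [hR.2 j] using hQ.mul_le_of_mem_matSpan (h (col_mem_matSpan R j)) i j

/-- a Kleene star is uniquely determined by its column span. -/
theorem stmt7 {n : ℕ} (Q R : Matrix (Fin n) (Fin n) ℝ≥0)
    (hQ : IsKleeneStar Q) (hR : IsKleeneStar R) :
    Q = R ↔ matSpan Q = matSpan R := by
  refine ⟨fun h => h ▸ rfl, fun h => ?_⟩
  ext i j : 2
  exact le_antisymm (hQ.le_of_matSpan_subset hR h.ge i j) (hR.le_of_matSpan_subset hQ h.le i j)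

end MaxAlg
end

section
/- For every matrix A ∈ ℝ₊^{n×m} with no zero rows there exist finitely many Kleene stars A^(1),…,A^(l) ∈ ℝ₊^{n×n} such that span(A) = span(A^(1)) ∪ … ∪ span(A^(l)). -/
open scoped NNReal Classical

namespace MaxAlg

noncomputable section

lemma mem_subEigCone {n : ℕ} {B : Matrix (Fin n) (Fin n) ℝ≥0} {y : Fin n → ℝ≥0} :
    y ∈ subEigCone B ↔ ∀ t i, B t i * y i ≤ y t := by
  simp [subEigCone, mulVec, Pi.le_def]

/-- If a matrix `B` admits a positive `z` with `B ⊗ z ≤ z`, then its subeigencone is the span of a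
Kleene star. -/
lemma exists_isKleeneStar_matSpan_eq {n : ℕ} (B : Matrix (Fin n) (Fin n) ℝ≥0)
    (z : Fin n → ℝ≥0) (hz : ∀ i, z i ≠ 0) (hBz : z ∈ subEigCone B) :
    ∃ Q : Matrix (Fin n) (Fin n) ℝ≥0, IsKleeneStar Q ∧ matSpan Q = subEigCone B := by
  simp only [mem_subEigCone] at hBz
  let C : Fin n → Set (Fin n → ℝ≥0) := fun j => { y | y ∈ subEigCone B ∧ y j = 1 }
  have hC : ∀ j, (C j).Nonempty := fun j => by
    refine ⟨fun i => z i / z j, mem_subEigCone.2 fun t i => ?_, div_self (hz j)⟩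
    rw [← mul_div_assoc]
    exact div_le_div_of_nonneg_right (hBz t i) zero_le
  let Q : Matrix (Fin n) (Fin n) ℝ≥0 := fun i j => sInf ((fun y => y i) '' C j)
  have hQ_le : ∀ i j, ∀ y ∈ C j, Q i j ≤ y i := fun i j y hy =>
    csInf_le (OrderBot.bddBelow _) ⟨y, hy, rfl⟩
  have le_hQ : ∀ i j (a : ℝ≥0), (∀ y ∈ C j, a ≤ y i) → a ≤ Q i j := fun i j a h =>
    le_csInf ((hC j).image _) (by rintro _ ⟨y, hy, rfl⟩; exact h y hy)
  have hQ_diag : ∀ i, Q i i = 1 := fun i => by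
    apply le_antisymm
    · obtain ⟨y, hy⟩ := hC i
      exact (hQ_le i i y hy).trans_eq hy.2
    · exact le_hQ i i 1 fun y hy => hy.2.ge
  have hQ_mem : ∀ t i j, B t i * Q i j ≤ Q t j := fun t i j =>
    le_hQ t j _ fun y hy =>
      (mul_le_mul_right (hQ_le i j y hy) _).trans (mem_subEigCone.1 hy.1 t i)
  have hQ_fix : ∀ y ∈ subEigCone B, mulVec Q y = y := fun y hy => by
    funext i
    apply le_antisymm
    · refine Finset.sup_le fun j _ => ?_
      by_cases hj : y j = 0
      · simp [hj]
      · rw [← le_div_iff₀ (pos_iff_ne_zero.2 hj)]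
        refine hQ_le i j (fun k => y k / y j) ⟨mem_subEigCone.2 fun t k => ?_, div_self hj⟩
        rw [← mul_div_assoc]
        exact div_le_div_of_nonneg_right (mem_subEigCone.1 hy t k) zero_le
    · calc y i = Q i i * y i := by rw [hQ_diag, one_mul]
        _ ≤ mulVec Q y i := Finset.le_sup (f := fun j => Q i j * y j) (Finset.mem_univ i)
  refine ⟨Q, ⟨?_, hQ_diag⟩, Set.Subset.antisymm ?_ fun y hy => ⟨y, (hQ_fix y hy).symm⟩⟩
  · funext i j
    exact congrFun (hQ_fix (fun t => Q t j) (mem_subEigCone.2 fun t k => hQ_mem t k j)) i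
  · rintro _ ⟨x, rfl⟩
    refine mem_subEigCone.2 fun t i => ?_
    simp only [mulVec, NNReal.mul_finset_sup]
    refine Finset.sup_mono_fun fun j _ => ?_
    rw [← mul_assoc]
    exact mul_le_mul_left (hQ_mem t i j) _

/-- The matrix whose `i`-th column is the column `σ i` of `A`, scaled to have `i`-th entry `1`. -/
def selMat {n m : ℕ} (A : Matrix (Fin n) (Fin m) ℝ≥0) (σ : Fin n → Fin m) :
    Matrix (Fin n) (Fin n) ℝ≥0 :=
  fun t i => A t (σ i) / A i (σ i)

lemma subEigCone_selMat_subset_matSpan {n m : ℕ} (A : Matrix (Fin n) (Fin m) ℝ≥0)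
    (σ : Fin n → Fin m) (hσ : ∀ i, A i (σ i) ≠ 0) :
    subEigCone (selMat A σ) ⊆ matSpan A := by
  intro y hy
  rw [mem_subEigCone] at hy
  refine ⟨fun j => Finset.univ.sup fun i => if σ i = j then y i / A i (σ i) else 0, ?_⟩
  funext t
  apply le_antisymm
  · calc y t = A t (σ t) * (y t / A t (σ t)) := (mul_div_cancel₀ _ (hσ t)).symm
      _ ≤ A t (σ t) * Finset.univ.sup fun i => if σ i = σ t then y i / A i (σ i) else 0 := by
        refine mul_le_mul_right ?_ _
        simpa using Finset.le_sup (f := fun i => if σ i = σ t then y i / A i (σ i) else 0)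
          (Finset.mem_univ t)
      _ ≤ _ := Finset.le_sup (f := fun j => A t j * Finset.univ.sup fun i =>
          if σ i = j then y i / A i (σ i) else 0) (Finset.mem_univ (σ t))
  · refine Finset.sup_le fun j _ => ?_
    rw [NNReal.mul_finset_sup]
    refine Finset.sup_le fun i _ => ?_
    split_ifs with h
    · subst h
      rw [← mul_div_assoc, mul_div_right_comm]
      exact hy t i
    · simp

/-- Every vector in the span of `A` lies in the subeigencone of some `selMat A σ` which also
contains a positive vector. -/
lemma exists_mem_subEigCone_selMat {n m : ℕ} (A : Matrix (Fin n) (Fin m) ℝ≥0)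
    (hA : ∀ i, ∃ j, A i j ≠ 0) {y : Fin n → ℝ≥0} (hy : y ∈ matSpan A) :
    ∃ σ : Fin n → Fin m, (∀ i, A i (σ i) ≠ 0) ∧ y ∈ subEigCone (selMat A σ) ∧
      ∃ z, (∀ i, z i ≠ 0) ∧ z ∈ subEigCone (selMat A σ) := by
  obtain ⟨x, hx⟩ := hy
  have hle : ∀ i j, A i j * x j ≤ y i := fun i j => by
    rw [hx]
    exact Finset.le_sup (f := fun j => A i j * x j) (Finset.mem_univ j)
  have key : ∀ i, ∃ j, A i j ≠ 0 ∧ (y i ≠ 0 → y i = A i j * x j) ∧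
      (y i = 0 → ∀ k, A i k ≤ A i j) := fun i => by
    have hne : (Finset.univ : Finset (Fin m)).Nonempty :=
      ⟨(hA i).choose, Finset.mem_univ _⟩
    by_cases hi : y i = 0
    · obtain ⟨j, -, hj⟩ := Finset.exists_max_image Finset.univ (fun j => A i j) hne
      obtain ⟨k, hk⟩ := hA i
      refine ⟨j, fun h => hk ?_, fun h => absurd hi h, fun _ k => hj k (Finset.mem_univ k)⟩
      simpa [h] using hj k (Finset.mem_univ k)
    · obtain ⟨j, -, hj⟩ := Finset.exists_mem_eq_sup Finset.univ hne fun j => A i j * x j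
      have hj' : y i = A i j * x j := by rw [hx]; exact hj
      exact ⟨j, fun h => hi (by rw [hj', h, zero_mul]), fun _ => hj', fun h => absurd h hi⟩
  choose σ hσ hσ₁ hσ₂ using key
  have hdiv : ∀ i, y i ≠ 0 → y i / A i (σ i) = x (σ i) := fun i hi => by
    rw [hσ₁ i hi, mul_div_cancel_left₀ _ (hσ i)]
  have hmul : ∀ t i (c : ℝ≥0), selMat A σ t i * c = A t (σ i) * (c / A i (σ i)) :=
    fun t i c => by rw [selMat, div_mul_eq_mul_div, mul_div_assoc]
  refine ⟨σ, hσ, mem_subEigCone.2 fun t i => ?_, ?_⟩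
  · by_cases hi : y i = 0
    · simp [hi]
    · rw [hmul, hdiv i hi]
      exact hle t _
  let K : ℝ≥0 := 1 + ∑ i, ∑ j, A i j / y i
  have hK : ∀ i j, y i ≠ 0 → A i j ≤ K * y i := fun i j hi => by
    rw [← div_le_iff₀ (pos_iff_ne_zero.2 hi)]
    calc A i j / y i ≤ ∑ j, A i j / y i :=
          Finset.single_le_sum (f := fun j => A i j / y i) (fun _ _ => zero_le) (Finset.mem_univ j)
      _ ≤ ∑ i, ∑ j, A i j / y i :=
          Finset.single_le_sum (f := fun i => ∑ j, A i j / y i) (fun _ _ => zero_le)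
            (Finset.mem_univ i)
      _ ≤ K := le_add_self
  have hK₀ : K ≠ 0 := (add_pos_of_pos_of_nonneg one_pos zero_le).ne'
  refine ⟨fun i => if y i = 0 then A i (σ i) else K * y i, fun i => ?_,
    mem_subEigCone.2 fun t i => ?_⟩
  · dsimp only
    split_ifs with hi
    exacts [hσ i, mul_ne_zero hK₀ hi]
  · simp only [hmul]
    by_cases hi : y i = 0
    · rw [if_pos hi, div_self (hσ i), mul_one]
      split_ifs with ht
      exacts [hσ₂ t ht _, hK t _ ht]
    · rw [if_neg hi, mul_div_assoc, hdiv i hi, mul_left_comm]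
      have h := mul_le_mul_right (hle t (σ i)) K
      split_ifs with ht
      · rw [ht, mul_zero] at h
        exact h.trans zero_le
      · exact h

end

/-- cellular decomposition: the span of any matrix with no zero rows is
a finite union of Kleene cones. -/
theorem stmt10 {n m : ℕ} (A : Matrix (Fin n) (Fin m) ℝ≥0)
    (hA : ∀ i, ∃ j, A i j ≠ 0) :
    ∃ (l : ℕ) (Q : Fin l → Matrix (Fin n) (Fin n) ℝ≥0),
      (∀ t, IsKleeneStar (Q t)) ∧ matSpan A = ⋃ t, matSpan (Q t) := by
  let T := { σ : Fin n → Fin m // (∀ i, A i (σ i) ≠ 0) ∧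
    ∃ z, (∀ i, z i ≠ 0) ∧ z ∈ subEigCone (selMat A σ) }
  have hT : ∀ σ : T, ∃ Q : Matrix (Fin n) (Fin n) ℝ≥0,
      IsKleeneStar Q ∧ matSpan Q = subEigCone (selMat A σ.1) := fun ⟨σ, _, z, hz, hBz⟩ =>
    exists_isKleeneStar_matSpan_eq (selMat A σ) z hz hBz
  choose Q hQ hspan using hT
  let e := Fintype.equivFin T
  refine ⟨Fintype.card T, fun t => Q (e.symm t), fun t => hQ _, Set.Subset.antisymm ?_ ?_⟩
  · intro y hy
    obtain ⟨σ, hσ, hyσ, hz⟩ := exists_mem_subEigCone_selMat A hA hy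
    refine Set.mem_iUnion.2 ⟨e ⟨σ, hσ, hz⟩, ?_⟩
    change y ∈ matSpan (Q (e.symm (e ⟨σ, hσ, hz⟩)))
    rw [e.symm_apply_apply, hspan]
    exact hyσ
  · refine Set.iUnion_subset fun t => ?_
    rw [hspan]
    exact subEigCone_selMat_subset_matSpan A _ (e.symm t).2.1

end MaxAlg
end

section
/- Let A ∈ ℝ₊^{n×m} have no zero rows and no zero columns, let y ∈ ℝ₊ⁿ have all coordinates positive, and let S be the row type of y with respect to A. Define the undirected graph G_S on node set [n] containing all loops (i,i) and, for i ≠ j, the edge {i,j} if and only if S_i ∩ S_j ≠ ∅. Then G_S coincides with the critical digraph C(A^S): every loop (i,i) is a critical edge of A^S, and for i ≠ j the directed edge (i,j) lies on a critical cycle of A^S if and only if S_i ∩ S_j ≠ ∅. -/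
open scoped NNReal Classical

namespace MaxAlg

theorem ne_zero_of_mem_rowType {n m : ℕ} {A : Matrix (Fin n) (Fin m) ℝ≥0}
    (hcol : ∀ j, ∃ i, A i j ≠ 0) {y : Fin n → ℝ≥0} (hy : ∀ i, 0 < y i)
    {i : Fin n} {k : Fin m} (hk : k ∈ rowType A y i) : A i k ≠ 0 := by
  intro h0
  obtain ⟨t, ht⟩ := hcol k
  have h := hk t
  rw [h0, zero_div] at h
  exact absurd h (not_le.2 (div_pos (pos_iff_ne_zero.2 ht) (hy t)))

theorem div_mul_le_of_mem_rowType {n m : ℕ} {A : Matrix (Fin n) (Fin m) ℝ≥0}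
    (hcol : ∀ j, ∃ i, A i j ≠ 0) {y : Fin n → ℝ≥0} (hy : ∀ i, 0 < y i)
    {j : Fin n} {k : Fin m} (hk : k ∈ rowType A y j) (i : Fin n) :
    A i k / A j k * y j ≤ y i := by
  have hA := pos_iff_ne_zero.2 (ne_zero_of_mem_rowType hcol hy hk)
  have h := hk i
  rw [div_le_div_iff₀ (hy i) (hy j)] at h
  rw [div_mul_eq_mul_div, div_le_iff₀ hA, mul_comm (y i)]
  exact h

theorem div_mul_eq_iff_mem_rowType {n m : ℕ} {A : Matrix (Fin n) (Fin m) ℝ≥0}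
    (hcol : ∀ j, ∃ i, A i j ≠ 0) {y : Fin n → ℝ≥0} (hy : ∀ i, 0 < y i)
    {j : Fin n} {k : Fin m} (hk : k ∈ rowType A y j) (i : Fin n) :
    A i k / A j k * y j = y i ↔ k ∈ rowType A y i := by
  have hA := ne_zero_of_mem_rowType hcol hy hk
  have hiff : A i k / A j k * y j = y i ↔ A i k / y i = A j k / y j := by
    rw [div_mul_eq_mul_div, div_eq_iff hA, div_eq_div_iff (hy i).ne' (hy j).ne',
      mul_comm (y i)]
  rw [hiff]
  exact ⟨fun h t => (hk t).trans h.ge, fun h => le_antisymm (hk i) (h j)⟩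

theorem exists_typeMat_eq {n m : ℕ} (A : Matrix (Fin n) (Fin m) ℝ≥0)
    (S : Fin n → Set (Fin m)) (i : Fin n) {j : Fin n} (hS : (S j).Nonempty) :
    ∃ k ∈ S j, typeMat A S i j = A i k / A j k := by
  obtain ⟨k, hk, h⟩ := (hS.image fun t => A i t / A j t).csSup_mem (Set.toFinite _)
  exact ⟨k, hk, by rw [typeMat, if_neg hS.ne_empty, ← h]⟩

theorem div_le_typeMat {n m : ℕ} (A : Matrix (Fin n) (Fin m) ℝ≥0)
    (S : Fin n → Set (Fin m)) (i : Fin n) {j : Fin n} {k : Fin m} (hk : k ∈ S j) :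
    A i k / A j k ≤ typeMat A S i j := by
  rw [typeMat, if_neg (Set.nonempty_of_mem hk).ne_empty]
  exact le_csSup (Set.toFinite _).bddAbove ⟨k, hk, rfl⟩

theorem typeMat_mul_le {n m : ℕ} {A : Matrix (Fin n) (Fin m) ℝ≥0}
    (hcol : ∀ j, ∃ i, A i j ≠ 0) {y : Fin n → ℝ≥0} (hy : ∀ i, 0 < y i) (i j : Fin n) :
    typeMat A (rowType A y) i j * y j ≤ y i := by
  rcases Set.eq_empty_or_nonempty (rowType A y j) with hS | hS
  · by_cases hij : i = j <;> simp [typeMat, hS, hij]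
  · obtain ⟨k, hk, h⟩ := exists_typeMat_eq A (rowType A y) i hS
    rw [h]
    exact div_mul_le_of_mem_rowType hcol hy hk i

theorem typeMat_mul_eq_iff {n m : ℕ} {A : Matrix (Fin n) (Fin m) ℝ≥0}
    (hcol : ∀ j, ∃ i, A i j ≠ 0) {y : Fin n → ℝ≥0} (hy : ∀ i, 0 < y i) {i j : Fin n}
    (hij : i ≠ j) :
    typeMat A (rowType A y) i j * y j = y i ↔ (rowType A y i ∩ rowType A y j).Nonempty := by
  constructor
  · intro h
    rcases Set.eq_empty_or_nonempty (rowType A y j) with hS | hS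
    · simp only [typeMat, hS, hij, if_true, if_false, zero_mul] at h
      exact absurd h (hy i).ne
    · obtain ⟨k, hk, hB⟩ := exists_typeMat_eq A (rowType A y) i hS
      rw [hB] at h
      exact ⟨k, (div_mul_eq_iff_mem_rowType hcol hy hk i).1 h, hk⟩
  · rintro ⟨k, hki, hkj⟩
    refine le_antisymm (typeMat_mul_le hcol hy i j) ?_
    rw [← (div_mul_eq_iff_mem_rowType hcol hy hkj i).2 hki]
    exact mul_le_mul_left (div_le_typeMat A (rowType A y) i hkj) _

theorem typeMat_self {n m : ℕ} {A : Matrix (Fin n) (Fin m) ℝ≥0}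
    (hcol : ∀ j, ∃ i, A i j ≠ 0) {y : Fin n → ℝ≥0} (hy : ∀ i, 0 < y i) (i : Fin n) :
    typeMat A (rowType A y) i i = 1 := by
  rcases Set.eq_empty_or_nonempty (rowType A y i) with hS | hS
  · simp [typeMat, hS]
  · obtain ⟨k, hk, h⟩ := exists_typeMat_eq A (rowType A y) i hS
    rw [h, div_self (ne_zero_of_mem_rowType hcol hy hk)]

/-- If `B` is diagonally scaled below `1` by a positive vector, every critical edge is tight. -/
theorem IsCriticalEdge.mul_eq {n : ℕ} {B : Matrix (Fin n) (Fin n) ℝ≥0} {y : Fin n → ℝ≥0}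
    (hy : ∀ i, 0 < y i) (hB : ∀ i j, B i j * y j ≤ y i) {i j : Fin n}
    (h : IsCriticalEdge B i j) : B i j * y j = y i := by
  obtain ⟨p, hp, c, t, rfl, rfl, hw⟩ := h
  obtain ⟨q, rfl⟩ : ∃ q, p = q + 1 := ⟨p - 1, by lia⟩
  have hnext (s : Fin (q + 1)) : (⟨((s : ℕ) + 1) % (q + 1), Nat.mod_lt _ hp⟩ : Fin (q + 1)) =
      s + 1 := by
    ext
    simp [Fin.val_add]
  simp only [hnext] at hw ⊢
  replace hw := NNReal.rpow_left_injective (by positivity) (hw.trans (NNReal.one_rpow _).symm)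
  have hpos (s : Fin (q + 1)) : 0 < B (c s) (c (s + 1)) := by
    refine pos_iff_ne_zero.2 fun h0 => ?_
    rw [Finset.prod_eq_zero (Finset.mem_univ s) h0] at hw
    exact zero_ne_one hw
  have hshift : ∏ s, y (c (s + 1)) = ∏ s, y (c s) :=
    Equiv.prod_comp (Equiv.addRight (1 : Fin (q + 1))) fun s => y (c s)
  by_contra hne
  have hlt : ∏ s, B (c s) (c (s + 1)) * y (c (s + 1)) < ∏ s, y (c s) :=
    Finset.prod_lt_prod (fun s _ => mul_pos (hpos s) (hy _)) (fun s _ => hB _ _)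
      ⟨t, Finset.mem_univ t, lt_of_le_of_ne (hB _ _) hne⟩
  rw [Finset.prod_mul_distrib, hw, one_mul, hshift] at hlt
  exact lt_irrefl _ hlt

theorem isCriticalEdge_self {n : ℕ} {B : Matrix (Fin n) (Fin n) ℝ≥0} {i : Fin n}
    (h : B i i = 1) : IsCriticalEdge B i i :=
  ⟨1, one_pos, fun _ => i, 0, rfl, rfl, by simp [h]⟩

theorem isCriticalEdge_of_mul_eq_one {n : ℕ} {B : Matrix (Fin n) (Fin n) ℝ≥0} {i j : Fin n}
    (h : B i j * B j i = 1) : IsCriticalEdge B i j :=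
  ⟨2, two_pos, ![i, j], 0, rfl, rfl, by simp [Fin.prod_univ_two, h]⟩

/-- for a positive `y` with row type `S`, the graph `G_S` coincides with
the critical digraph `C(A^S)`. -/
theorem stmt11 {n m : ℕ} (A : Matrix (Fin n) (Fin m) ℝ≥0)
    (hrow : ∀ i, ∃ j, A i j ≠ 0) (hcol : ∀ j, ∃ i, A i j ≠ 0)
    (y : Fin n → ℝ≥0) (hy : ∀ i, 0 < y i) :
    (∀ i, IsCriticalEdge (typeMat A (rowType A y)) i i) ∧
    ∀ i j, i ≠ j →
      (IsCriticalEdge (typeMat A (rowType A y)) i j ↔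
        (rowType A y i ∩ rowType A y j).Nonempty) := by
  refine ⟨fun i => isCriticalEdge_self (typeMat_self hcol hy i), fun i j hij => ⟨fun h => ?_,
    fun h => isCriticalEdge_of_mul_eq_one ?_⟩⟩
  · exact (typeMat_mul_eq_iff hcol hy hij).1 (h.mul_eq hy (typeMat_mul_le hcol hy))
  · have h₁ := (typeMat_mul_eq_iff hcol hy hij).2 h
    have h₂ := (typeMat_mul_eq_iff hcol hy hij.symm).2 (Set.inter_comm _ _ ▸ h)
    rw [← eq_div_iff (hy _).ne'] at h₁ h₂
    rw [h₁, h₂, div_mul_div_cancel₀ (hy j).ne', div_self (hy i).ne']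

end MaxAlg
end

section
/- Let A ∈ ℝ₊^{n×n} have per(A) > 0 and let σ be a maximal permutation of A. Then the Kleene stars of the associated column and row normalizations satisfy (A^{cσ})* = D^σ ⊗ A^∇ = A ⊗ A^∇ and (A^{rσ})* = A^∇ ⊗ D^σ = A^∇ ⊗ A (all products max-algebraic). -/
open scoped NNReal Classical

namespace MaxAlg

section KleeneStar

open Finset Equiv

theorem not_sameCycle_of_invariant {α : Type*} [Finite α] {ρ : Perm α} {S : Set α} {i j : α}
    (hS : ∀ x ∈ S, ρ x ∈ S) (hi : i ∈ S) (hj : j ∉ S) : ¬ ρ.SameCycle i j := by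
  intro h
  obtain ⟨q, rfl⟩ := h.exists_nat_pow_eq
  apply hj
  clear hj h
  induction q with
  | zero => simpa using hi
  | succ q ih => rw [pow_succ', Perm.mul_apply]; exact hS _ ih

/-- Composing with a transposition merges or splits cycles: two points cannot share a cycle both
before and after. -/
theorem not_sameCycle_or_not_sameCycle_mul_swap {α : Type*} [Finite α] [DecidableEq α]
    (τ : Perm α) {i j : α} (hij : i ≠ j) :
    ¬ τ.SameCycle i j ∨ ¬ (τ * swap i j).SameCycle i j := by
  have hex : ∃ p, 0 < p ∧ ((τ ^ p) j = i ∨ (τ ^ p) j = j) :=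
    ⟨orderOf τ, orderOf_pos τ, Or.inr (by simp [pow_orderOf_eq_one])⟩
  obtain ⟨hp, hret⟩ := Nat.find_spec hex
  have hmin : ∀ q, 0 < q → q < Nat.find hex → (τ ^ q) j ≠ i ∧ (τ ^ q) j ≠ j := by
    intro q hq hlt
    have := Nat.find_min hex hlt
    tauto
  generalize Nat.find hex = p at hp hret hmin
  let S : Set α := {x | ∃ q, 0 < q ∧ q ≤ p ∧ (τ ^ q) j = x}
  rcases hret with hret | hret
  · right
    refine not_sameCycle_of_invariant (S := S) ?_ ⟨p, hp, le_rfl, hret⟩ ?_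
    · rintro x ⟨q, hq, hqp, rfl⟩
      rcases hqp.eq_or_lt with rfl | hlt
      · exact ⟨1, one_pos, hp, by simp [hret]⟩
      · refine ⟨q + 1, q.succ_pos, hlt, ?_⟩
        rw [Perm.mul_apply, swap_apply_of_ne_of_ne (hmin q hq hlt).1 (hmin q hq hlt).2, pow_succ',
          Perm.mul_apply]
    · rintro ⟨q, hq, hqp, h⟩
      rcases hqp.eq_or_lt with rfl | hlt
      · exact hij (hret.symm.trans h)
      · exact (hmin q hq hlt).2 h
  · left
    rw [Perm.sameCycle_comm]
    refine not_sameCycle_of_invariant (S := S) ?_ ⟨p, hp, le_rfl, hret⟩ ?_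
    · rintro x ⟨q, hq, hqp, rfl⟩
      rcases hqp.eq_or_lt with rfl | hlt
      · exact ⟨1, one_pos, hp, by simp [hret]⟩
      · exact ⟨q + 1, q.succ_pos, hlt, by rw [pow_succ', Perm.mul_apply]⟩
    · rintro ⟨q, hq, hqp, h⟩
      rcases hqp.eq_or_lt with rfl | hlt
      · exact hij (h.symm.trans hret)
      · exact (hmin q hq hlt).1 h

/-- A matrix with unit diagonal whose permanent is attained by the identity. -/
structure IsStronglyDefinite {n : ℕ} (B : Matrix (Fin n) (Fin n) ℝ≥0) : Prop where
  diag : ∀ i, B i i = 1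
  prod_perm_le : ∀ τ : Perm (Fin n), ∏ k, B k (τ k) ≤ 1

/-- The maximum weight of a permutation `τ` with `τ j = i`, leaving out the factor at `j`. -/
noncomputable def maxCofactor {n : ℕ} (A : Matrix (Fin n) (Fin n) ℝ≥0) (i j : Fin n) : ℝ≥0 :=
  (univ.filter fun τ : Perm (Fin n) => τ j = i).sup fun τ => ∏ k ∈ univ.erase j, A k (τ k)

variable {n : ℕ}

theorem prod_le_maxCofactor (A : Matrix (Fin n) (Fin n) ℝ≥0) (τ : Perm (Fin n)) (j : Fin n) :
    ∏ k ∈ univ.erase j, A k (τ k) ≤ maxCofactor A (τ j) j :=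
  le_sup (f := fun τ : Perm (Fin n) => ∏ k ∈ univ.erase j, A k (τ k)) (by simp)

theorem maxCofactor_le {A : Matrix (Fin n) (Fin n) ℝ≥0} {i j : Fin n} {c : ℝ≥0}
    (h : ∀ τ : Perm (Fin n), τ j = i → ∏ k ∈ univ.erase j, A k (τ k) ≤ c) :
    maxCofactor A i j ≤ c :=
  Finset.sup_le fun τ hτ => h τ (by simpa using hτ)

theorem exists_maxCofactor_eq (A : Matrix (Fin n) (Fin n) ℝ≥0) (i j : Fin n) :
    ∃ τ : Perm (Fin n), τ j = i ∧ maxCofactor A i j = ∏ k ∈ univ.erase j, A k (τ k) := by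
  obtain ⟨τ, hτ, h⟩ := exists_mem_eq_sup (univ.filter fun τ : Perm (Fin n) => τ j = i)
    ⟨swap i j, by simp⟩ fun τ => ∏ k ∈ univ.erase j, A k (τ k)
  exact ⟨τ, by simpa using hτ, h⟩

namespace IsStronglyDefinite

variable {B : Matrix (Fin n) (Fin n) ℝ≥0}

theorem prod_sameCycle_le (hB : IsStronglyDefinite B) (ρ : Perm (Fin n)) (i : Fin n) :
    ∏ k, (if ρ.SameCycle i k then B k (ρ k) else 1) ≤ 1 := by
  convert hB.prod_perm_le (ρ.cycleOf i) using 2 with k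
  rw [Perm.cycleOf_apply]
  split_ifs
  · rfl
  · exact (hB.diag k).symm

theorem inv_cycleOf_mul_apply (ρ : Perm (Fin n)) (i k : Fin n) :
    ((ρ.cycleOf i)⁻¹ * ρ) k = if ρ.SameCycle i k then k else ρ k := by
  rw [Perm.mul_apply, Perm.inv_eq_iff_eq, Perm.cycleOf_apply]
  by_cases h : ρ.SameCycle i k <;> simp [h]

theorem prod_not_sameCycle_le (hB : IsStronglyDefinite B) (ρ : Perm (Fin n)) (i : Fin n) :
    ∏ k, (if ρ.SameCycle i k then 1 else B k (ρ k)) ≤ 1 := by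
  convert hB.prod_perm_le ((ρ.cycleOf i)⁻¹ * ρ) using 2 with k
  rw [inv_cycleOf_mul_apply]
  split_ifs
  · exact (hB.diag k).symm
  · rfl

/-- Replacing a cycle that avoids `j` by fixed points does not decrease the weight. -/
theorem exists_perm_fixing (hB : IsStronglyDefinite B) {ρ : Perm (Fin n)} {i j : Fin n}
    (h : ¬ ρ.SameCycle i j) :
    ∃ π : Perm (Fin n), π i = i ∧ π j = ρ j ∧
      ∏ k ∈ univ.erase j, B k (ρ k) ≤ ∏ k ∈ univ.erase j, B k (π k) := by
  refine ⟨(ρ.cycleOf i)⁻¹ * ρ, ?_, ?_, ?_⟩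
  · simp [inv_cycleOf_mul_apply, Perm.SameCycle.refl]
  · simp [inv_cycleOf_mul_apply, h]
  · have hsplit : ∏ k ∈ univ.erase j, B k (ρ k) =
        (∏ k ∈ univ.erase j, if ρ.SameCycle i k then B k (ρ k) else 1) *
          ∏ k ∈ univ.erase j, B k (((ρ.cycleOf i)⁻¹ * ρ) k) := by
      rw [← prod_mul_distrib]
      refine prod_congr rfl fun k _ => ?_
      rw [inv_cycleOf_mul_apply]
      split_ifs <;> simp [hB.diag]
    rw [hsplit]
    refine mul_le_of_le_one_left' ?_
    rw [prod_erase _ (by simp [h])]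
    exact hB.prod_sameCycle_le ρ i

theorem mul_prod_eq_swap (τ : Perm (Fin n)) {i j : Fin n} (hij : i ≠ j) :
    B i (τ j) * ∏ k ∈ univ.erase j, B k (τ k) =
      B i (τ i) * ∏ k ∈ univ.erase j, B k ((τ * swap i j) k) := by
  have hi : i ∈ (univ : Finset (Fin n)).erase j := by simp [hij]
  rw [← mul_prod_erase _ _ hi, ← mul_prod_erase _ _ hi]
  have : ∏ k ∈ (univ.erase j).erase i, B k ((τ * swap i j) k) =
      ∏ k ∈ (univ.erase j).erase i, B k (τ k) := by
    refine prod_congr rfl fun k hk => ?_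
    simp only [mem_erase] at hk
    rw [Perm.mul_apply, swap_apply_of_ne_of_ne hk.1 hk.2.1]
  rw [this, Perm.mul_apply, swap_apply_left]
  ring

theorem mul_prod_le_of_not_sameCycle (hB : IsStronglyDefinite B) {ρ : Perm (Fin n)} {i j : Fin n}
    (hij : i ≠ j) (h : ¬ ρ.SameCycle i j) :
    B i (ρ j) * ∏ k ∈ univ.erase j, B k (ρ k) ≤ maxCofactor B i j := by
  obtain ⟨π, hi, hj, hle⟩ := hB.exists_perm_fixing h
  calc B i (ρ j) * ∏ k ∈ univ.erase j, B k (ρ k)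
      ≤ B i (π j) * ∏ k ∈ univ.erase j, B k (π k) := by rw [hj]; gcongr
    _ = ∏ k ∈ univ.erase j, B k ((π * swap i j) k) := by
      rw [mul_prod_eq_swap π hij, hi, hB.diag, one_mul]
    _ ≤ maxCofactor B i j := by
      simpa [hi] using prod_le_maxCofactor B (π * swap i j) j

theorem one_le_maxCofactor_self (hB : IsStronglyDefinite B) (i : Fin n) :
    1 ≤ maxCofactor B i i := by
  simpa [hB.diag] using prod_le_maxCofactor B 1 i

theorem mul_maxCofactor_le (hB : IsStronglyDefinite B) (i l j : Fin n) :
    B i l * maxCofactor B l j ≤ maxCofactor B i j := by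
  obtain ⟨τ, rfl, h⟩ := exists_maxCofactor_eq B l j
  rw [h]
  rcases eq_or_ne i j with rfl | hij
  · rw [mul_prod_erase univ (fun k => B k (τ k)) (mem_univ i)]
    exact (hB.prod_perm_le τ).trans (hB.one_le_maxCofactor_self i)
  · rcases not_sameCycle_or_not_sameCycle_mul_swap τ hij with hc | hc
    · exact hB.mul_prod_le_of_not_sameCycle hij hc
    · rw [mul_prod_eq_swap τ hij]
      simpa using hB.mul_prod_le_of_not_sameCycle hij hc

end IsStronglyDefinite

theorem le_mProd (A B : Matrix (Fin n) (Fin n) ℝ≥0) (i t j : Fin n) :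
    A i t * B t j ≤ mProd A B i j :=
  le_sup (f := fun t => A i t * B t j) (mem_univ t)

theorem mProd_le {A B : Matrix (Fin n) (Fin n) ℝ≥0} {i j : Fin n} {c : ℝ≥0}
    (h : ∀ t, A i t * B t j ≤ c) : mProd A B i j ≤ c :=
  Finset.sup_le fun t _ => h t

theorem mProd_assoc (A B C : Matrix (Fin n) (Fin n) ℝ≥0) :
    mProd (mProd A B) C = mProd A (mProd B C) := by
  ext i j : 1
  simp only [mProd, NNReal.mul_finset_sup, NNReal.finset_sup_mul]
  rw [Finset.sup_comm]
  simp only [mul_assoc]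

theorem mProd_mId (A : Matrix (Fin n) (Fin n) ℝ≥0) : mProd A (mId n) = A := by
  ext i j : 1
  refine le_antisymm (mProd_le fun t => ?_) ?_
  · unfold mId
    split_ifs with h <;> simp [h]
  · simpa [mId] using le_mProd A (mId n) i j j

theorem mId_mProd (A : Matrix (Fin n) (Fin n) ℝ≥0) : mProd (mId n) A = A := by
  ext i j : 1
  refine le_antisymm (mProd_le fun t => ?_) ?_
  · unfold mId
    split_ifs with h <;> simp [h]
  · simpa [mId] using le_mProd (mId n) A i i j

theorem mPow_succ_eq_mProd_mPow (A : Matrix (Fin n) (Fin n) ℝ≥0) (t : ℕ) :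
    mPow A (t + 1) = mProd A (mPow A t) := by
  induction t with
  | zero => simp [mPow, mProd_mId, mId_mProd]
  | succ t ih =>
    calc mPow A (t + 2) = mProd (mPow A (t + 1)) A := rfl
      _ = mProd A (mProd (mPow A t) A) := by rw [ih, mProd_assoc]

theorem mProd_transpose (A B : Matrix (Fin n) (Fin n) ℝ≥0) :
    mProd A.transpose B.transpose = (mProd B A).transpose := by
  ext i j : 1
  simp only [mProd, Matrix.transpose_apply, mul_comm]

theorem mPow_transpose (A : Matrix (Fin n) (Fin n) ℝ≥0) (t : ℕ) :
    mPow A.transpose t = (mPow A t).transpose := by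
  induction t with
  | zero => ext i j : 1; simp [mPow, mId, eq_comm]
  | succ t ih =>
    rw [mPow_succ_eq_mProd_mPow, ih, mProd_transpose]
    rfl

theorem kleene_transpose (A : Matrix (Fin n) (Fin n) ℝ≥0) :
    kleene A.transpose = (kleene A).transpose := by
  ext i j : 1
  simp only [kleene, mPow_transpose, Matrix.transpose_apply]

theorem prod_walk_le_mPow (B : Matrix (Fin n) (Fin n) ℝ≥0) (f : ℕ → Fin n) (t : ℕ) :
    ∏ s ∈ range t, B (f s) (f (s + 1)) ≤ mPow B t (f 0) (f t) := by
  induction t with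
  | zero => simp [mPow, mId]
  | succ t ih =>
    rw [prod_range_succ]
    exact (mul_le_mul_left ih _).trans (le_mProd (mPow B t) B (f 0) (f t) (f (t + 1)))

namespace IsStronglyDefinite

variable {B : Matrix (Fin n) (Fin n) ℝ≥0}

theorem mPow_le_maxCofactor (hB : IsStronglyDefinite B) (t : ℕ) (i j : Fin n) :
    mPow B t i j ≤ maxCofactor B i j := by
  induction t generalizing i with
  | zero =>
    simp only [mPow, mId]
    split_ifs with h
    · subst h
      exact hB.one_le_maxCofactor_self i
    · exact zero_le
  | succ t ih =>
    rw [mPow_succ_eq_mProd_mPow]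
    exact mProd_le fun l => (mul_le_mul_right (ih l) _).trans (hB.mul_maxCofactor_le i l j)

theorem prod_erase_le_kleene (hB : IsStronglyDefinite B) (τ : Perm (Fin n)) (j : Fin n) :
    ∏ k ∈ univ.erase j, B k (τ k) ≤ kleene B (τ j) j := by
  obtain ⟨p, hp⟩ : ∃ p, Function.minimalPeriod τ j = p + 1 :=
    Nat.exists_eq_succ_of_ne_zero (Function.minimalPeriod_pos_of_mem_periodicPts
      (τ.injective.mem_periodicPts j)).ne'
  have hinj : Set.InjOn (fun q => τ^[q] j) (Set.Iio (p + 1)) := by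
    rw [← hp]
    exact Function.iterate_injOn_Iio_minimalPeriod
  have hpn : p < n := by
    have := card_le_univ ((range (p + 1)).image fun q => τ^[q] j)
    rw [card_image_of_injOn (by simpa using hinj)] at this
    simpa using this
  have hcycle : (univ.erase j).filter (fun k => τ.SameCycle j k) =
      (range p).image fun s => τ^[s + 1] j := by
    ext k
    simp only [mem_filter, mem_erase, mem_univ, and_true, mem_image, mem_range]
    constructor
    · rintro ⟨hk, hc⟩
      obtain ⟨q, rfl⟩ := hc.exists_nat_pow_eq
      rw [← Perm.iterate_eq_pow, ← Function.iterate_mod_minimalPeriod_eq, hp] at hk ⊢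
      have hlt : q % (p + 1) < p + 1 := Nat.mod_lt q p.succ_pos
      rcases hr : q % (p + 1) with _ | s
      · simp [hr] at hk
      · exact ⟨s, by omega, rfl⟩
    · rintro ⟨s, hs, rfl⟩
      refine ⟨fun h => ?_, ⟨s + 1, by rw [Perm.iterate_eq_pow]; rfl⟩⟩
      have := hinj (Set.mem_Iio.2 (Nat.succ_lt_succ hs)) (Set.mem_Iio.2 p.succ_pos) h
      omega
  have hsplit : ∏ k ∈ univ.erase j, B k (τ k) =
      (∏ s ∈ range p, B (τ^[s + 1] j) (τ^[s + 1 + 1] j)) *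
        ∏ k, (if τ.SameCycle j k then 1 else B k (τ k)) := by
    rw [← prod_filter_mul_prod_filter_not (univ.erase j) (fun k => τ.SameCycle j k), hcycle,
      prod_image]
    · congr 1
      · simp only [Function.iterate_succ_apply']
      · rw [← prod_erase univ (a := j) (by simp [Perm.SameCycle.refl]), prod_filter]
        simp only [ite_not]
    · intro a ha b hb hab
      have := hinj (Set.mem_Iio.2 (Nat.succ_lt_succ (mem_range.1 ha)))
        (Set.mem_Iio.2 (Nat.succ_lt_succ (mem_range.1 hb))) hab
      omega
  have hret : τ^[p + 1] j = j := by rw [← hp, Function.iterate_minimalPeriod]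
  have hwalk := prod_walk_le_mPow B (fun s => τ^[s + 1] j) p
  simp only [hret] at hwalk
  rw [hsplit]
  exact (mul_le_of_le_one_right' (hB.prod_not_sameCycle_le τ j)).trans
    (hwalk.trans (le_sup (f := fun t => mPow B t (τ j) j) (mem_range.2 hpn)))

theorem kleene_eq_maxCofactor (hB : IsStronglyDefinite B) : kleene B = maxCofactor B := by
  ext i j : 1
  refine le_antisymm (Finset.sup_le fun t _ => hB.mPow_le_maxCofactor t i j) (maxCofactor_le ?_)
  rintro τ rfl
  exact hB.prod_erase_le_kleene τ j

end IsStronglyDefinite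

theorem prod_le_maxPer (A : Matrix (Fin n) (Fin n) ℝ≥0) (τ : Perm (Fin n)) :
    ∏ k, A k (τ k) ≤ maxPer A :=
  le_sup (f := fun τ : Perm (Fin n) => ∏ k, A k (τ k)) (mem_univ τ)

theorem maxPer_transpose (A : Matrix (Fin n) (Fin n) ℝ≥0) : maxPer A.transpose = maxPer A := by
  have key (M : Matrix (Fin n) (Fin n) ℝ≥0) : maxPer M.transpose ≤ maxPer M := by
    refine Finset.sup_le fun τ _ => ?_
    rw [← Equiv.prod_comp τ⁻¹]
    simpa using prod_le_maxPer M τ⁻¹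
  exact le_antisymm (key A) (key A.transpose)

theorem pinv_transpose {N : ℕ} (A : Matrix (Fin (N + 1)) (Fin (N + 1)) ℝ≥0) :
    pinv A.transpose = (pinv A).transpose := by
  ext i j : 1
  simp only [pinv, maxPer_transpose, Matrix.transpose_apply]
  rw [← maxPer_transpose (A.submatrix i.succAbove j.succAbove)]
  rfl

theorem prod_erase_eq_prod_succAbove {N : ℕ} (f : Fin (N + 1) → ℝ≥0) (j : Fin (N + 1)) :
    ∏ k ∈ univ.erase j, f k = ∏ k, f (j.succAbove k) := by
  rw [← compl_singleton, ← Fin.image_succAbove_univ,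
    prod_image fun _ _ _ _ h => Fin.succAbove_right_injective h]

theorem maxPer_minor {N : ℕ} (A : Matrix (Fin (N + 1)) (Fin (N + 1)) ℝ≥0) (i j : Fin (N + 1)) :
    maxPer (A.submatrix j.succAbove i.succAbove) = maxCofactor A i j := by
  refine le_antisymm (Finset.sup_le fun π _ => ?_) (maxCofactor_le fun τ hτ => ?_)
  · let τ : Perm (Fin (N + 1)) :=
      (finSuccEquiv' j).trans ((optionCongr π).trans (finSuccEquiv' i).symm)
    have hj : τ j = i := by simp [τ]
    have hk (k : Fin N) : τ (j.succAbove k) = i.succAbove (π k) := by simp [τ]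
    have h := prod_le_maxCofactor A τ j
    rw [prod_erase_eq_prod_succAbove, hj] at h
    simp only [hk] at h
    exact h
  · let e : Option (Fin N) ≃ Option (Fin N) :=
      (finSuccEquiv' j).symm.trans (τ.trans (finSuccEquiv' i))
    have hk (k : Fin N) : τ (j.succAbove k) = i.succAbove (removeNone e k) := by
      have hne : e (some k) ≠ none := by
        have h0 : e none = none := by simp [e, hτ]
        rw [← h0]
        exact e.injective.ne (by simp)
      have hs := removeNone_some e (Option.ne_none_iff_exists'.1 hne)
      have := congrArg (finSuccEquiv' i).symm hs
      simpa [e] using this.symm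
    rw [prod_erase_eq_prod_succAbove]
    simpa [hk] using prod_le_maxPer (A.submatrix j.succAbove i.succAbove) (removeNone e)

section Normalization

variable {A : Matrix (Fin n) (Fin n) ℝ≥0} {σ : Perm (Fin n)}

theorem colNorm_mul (hA : ∀ l, A l (σ l) ≠ 0) (i l : Fin n) :
    colNorm A σ i l * A l (σ l) = A i (σ l) :=
  div_mul_cancel₀ _ (hA l)

theorem ne_zero_of_prod_eq_maxPer (hper : 0 < maxPer A) (hσ : ∏ i, A i (σ i) = maxPer A)
    (l : Fin n) : A l (σ l) ≠ 0 :=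
  prod_ne_zero_iff.1 (hσ.trans_ne hper.ne') l (mem_univ l)

theorem isStronglyDefinite_colNorm (hper : 0 < maxPer A) (hσ : ∏ i, A i (σ i) = maxPer A) :
    IsStronglyDefinite (colNorm A σ) where
  diag i := div_self (ne_zero_of_prod_eq_maxPer hper hσ i)
  prod_perm_le τ := by
    simp only [colNorm]
    rw [prod_div_distrib, Equiv.prod_comp τ fun l => A l (σ l), hσ]
    exact div_le_one_of_le₀ (prod_le_maxPer A (σ * τ)) zero_le

theorem mul_prod_erase_eq (hA : ∀ l, A l (σ l) ≠ 0) (hσ : ∏ i, A i (σ i) = maxPer A)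
    (τ : Perm (Fin n)) (j : Fin n) :
    A (τ j) (σ (τ j)) * ∏ k ∈ univ.erase j, A k ((σ * τ) k) =
      maxPer A * ∏ k ∈ univ.erase j, colNorm A σ k (τ k) := by
  have h : ∏ k ∈ univ.erase j, A k ((σ * τ) k) =
      (∏ k ∈ univ.erase j, colNorm A σ k (τ k)) *
        ∏ k ∈ univ.erase j, A (τ k) (σ (τ k)) := by
    rw [← prod_mul_distrib]
    exact prod_congr rfl fun k _ => (colNorm_mul hA k (τ k)).symm
  rw [h, ← hσ, ← Equiv.prod_comp τ fun l => A l (σ l), ← mul_prod_erase univ _ (mem_univ j)]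
  ring

theorem mul_maxCofactor_eq (hA : ∀ l, A l (σ l) ≠ 0) (hσ : ∏ i, A i (σ i) = maxPer A)
    (i j : Fin n) :
    A i (σ i) * maxCofactor A (σ i) j = maxPer A * maxCofactor (colNorm A σ) i j := by
  apply le_antisymm
  · obtain ⟨τ, hτ, h⟩ := exists_maxCofactor_eq A (σ i) j
    have hi : (σ⁻¹ * τ) j = i := by simp [hτ]
    have key := mul_prod_erase_eq hA hσ (σ⁻¹ * τ) j
    rw [mul_inv_cancel_left, hi] at key
    rw [h, key]
    gcongr
    simpa only [hi] using prod_le_maxCofactor (colNorm A σ) (σ⁻¹ * τ) j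
  · obtain ⟨τ, rfl, h⟩ := exists_maxCofactor_eq (colNorm A σ) i j
    rw [h, ← mul_prod_erase_eq hA hσ τ j]
    gcongr
    exact prod_le_maxCofactor A (σ * τ) j

end Normalization

section PseudoInverse

variable {N : ℕ} {A : Matrix (Fin (N + 1)) (Fin (N + 1)) ℝ≥0} {σ : Perm (Fin (N + 1))}

theorem mul_pinv_eq_kleene (hper : 0 < maxPer A) (hσ : ∏ i, A i (σ i) = maxPer A)
    (i j : Fin (N + 1)) : A i (σ i) * pinv A (σ i) j = kleene (colNorm A σ) i j := by
  rw [pinv, maxPer_minor, mul_left_comm,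
    mul_maxCofactor_eq (ne_zero_of_prod_eq_maxPer hper hσ) hσ, inv_mul_cancel_left₀ hper.ne',
    (isStronglyDefinite_colNorm hper hσ).kleene_eq_maxCofactor]

theorem kleene_colNorm_eq_permDiag_mProd (hper : 0 < maxPer A)
    (hσ : ∏ i, A i (σ i) = maxPer A) :
    kleene (colNorm A σ) = mProd (permDiag A σ) (pinv A) := by
  ext i j : 1
  rw [← mul_pinv_eq_kleene hper hσ]
  refine le_antisymm ?_ (mProd_le fun t => ?_)
  · simpa [permDiag] using le_mProd (permDiag A σ) (pinv A) i (σ i) j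
  · unfold permDiag
    split_ifs with h <;> simp [h]

theorem kleene_colNorm_eq_mProd (hper : 0 < maxPer A) (hσ : ∏ i, A i (σ i) = maxPer A) :
    kleene (colNorm A σ) = mProd A (pinv A) := by
  ext i j : 1
  refine le_antisymm ?_ (mProd_le fun t => ?_)
  · rw [← mul_pinv_eq_kleene hper hσ]
    exact le_mProd A (pinv A) i (σ i) j
  · obtain ⟨l, rfl⟩ := σ.surjective t
    have hB := isStronglyDefinite_colNorm hper hσ
    rw [← colNorm_mul (ne_zero_of_prod_eq_maxPer hper hσ), mul_assoc,
      mul_pinv_eq_kleene hper hσ, hB.kleene_eq_maxCofactor]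
    exact hB.mul_maxCofactor_le i l j

end PseudoInverse

theorem rowNorm_eq_transpose (A : Matrix (Fin n) (Fin n) ℝ≥0) (σ : Perm (Fin n)) :
    rowNorm A σ = (colNorm A.transpose σ.symm).transpose := rfl

theorem permDiag_transpose (A : Matrix (Fin n) (Fin n) ℝ≥0) (σ : Perm (Fin n)) :
    permDiag A.transpose σ.symm = (permDiag A σ).transpose := by
  ext i j : 1
  simp only [permDiag, Matrix.transpose_apply, Equiv.eq_symm_apply, eq_comm]

end KleeneStar

/-- column and row Kleene stars equal `A ⊗ A^∇` and `A^∇ ⊗ A`. -/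
theorem stmt12 {N : ℕ} (A : Matrix (Fin (N + 1)) (Fin (N + 1)) ℝ≥0)
    (hper : 0 < maxPer A) (σ : Equiv.Perm (Fin (N + 1)))
    (hσ : (∏ i, A i (σ i)) = maxPer A) :
    kleene (colNorm A σ) = mProd (permDiag A σ) (pinv A) ∧
    kleene (colNorm A σ) = mProd A (pinv A) ∧
    kleene (rowNorm A σ) = mProd (pinv A) (permDiag A σ) ∧
    kleene (rowNorm A σ) = mProd (pinv A) A := by
  have hper' : 0 < maxPer A.transpose := by rwa [maxPer_transpose]
  have hσ' : ∏ i, A.transpose i (σ.symm i) = maxPer A.transpose := by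
    rw [maxPer_transpose, ← hσ, ← Equiv.prod_comp σ]
    simp
  refine ⟨kleene_colNorm_eq_permDiag_mProd hper hσ, kleene_colNorm_eq_mProd hper hσ, ?_, ?_⟩
  · rw [rowNorm_eq_transpose, kleene_transpose, kleene_colNorm_eq_permDiag_mProd hper' hσ',
      permDiag_transpose, pinv_transpose, mProd_transpose, Matrix.transpose_transpose]
  · rw [rowNorm_eq_transpose, kleene_transpose, kleene_colNorm_eq_mProd hper' hσ',
      pinv_transpose, mProd_transpose, Matrix.transpose_transpose]

end MaxAlg
end
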